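/- arXiv:1308.0632 — 2 statements merged into one kernel-verified Lean document; each statement's English description precedes it below -/
import Mathlib

section
/- Let F be a field of characteristic 0, s ≥ 3 and n ≥ 2 integers, and let S be the Hamming source over F with s terminals and blocklength n. Then there exist matrices H_1, …, H_s over F, with H_i of size m_i × n, forming a lossless linear compression of S with total code length m_1 + ⋯ + m_s = max(n + 2, 2s); in particular this compression is linear-optimal, i.e. no lossless linear compression of S has strictly smaller total code length. -/
open Matrix

/-- The Hamming source over `F` with `s` terminals and blocklength `n`: all tuples
`(v,…,v) + δ` where `δ` is zero except possibly in one component, which is `a·e_j`. -/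
def HammingSource (F : Type*) [Field F] (s n : ℕ) : Set (Fin s → Fin n → F) :=
  {x | ∃ (v : Fin n → F) (i : Fin s) (a : F) (j : Fin n),
    x = fun i' => if i' = i then v + a • (Pi.single j (1 : F) : Fin n → F) else v}

/-- `(H_1, …, H_s)` is a lossless linear compression of `S`. -/
def Lossless {F : Type*} [Field F] {s n : ℕ} {m : Fin s → ℕ}
    (H : ∀ i, Matrix (Fin (m i)) (Fin n) F) (S : Set (Fin s → Fin n → F)) : Prop :=
  Set.InjOn (fun x (i : Fin s) => (H i).mulVec (x i)) S

open Polynomial in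
/-- If the polynomial pairs `(p i, q i)` are pairwise non-proportional over `F[X]` and each pair is
linearly independent over `F`, then over an infinite field there are distinct evaluation points
at which all the resulting vectors of `F²` are pairwise non-proportional. -/
theorem exists_seq_eval_pairwise_det_ne_zero {F ι : Type*} [Field F] [Infinite F] [Finite ι]
    [Nontrivial ι] (p q : ι → F[X]) (hdet : ∀ i k, i ≠ k → p i * q k - q i * p k ≠ 0)
    (hind : ∀ i (x y : F), C x * q i - C y * p i = 0 → x = 0 ∧ y = 0) :
    ∃ τ : ℕ → F, Function.Injective τ ∧ ∀ i j k l, (i, j) ≠ (k, l) →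
      (p i).eval (τ j) * (q k).eval (τ l) - (q i).eval (τ j) * (p k).eval (τ l) ≠ 0 := by
  classical
  have := Fintype.ofFinite ι
  obtain ⟨τ, hP, hr⟩ := exists_seq_of_forall_finset_exists
    (fun τ : F => ∀ i k, i ≠ k → (p i * q k - q i * p k).eval τ ≠ 0)
    (fun σ τ : F => σ ≠ τ ∧ ∀ i k,
      (C ((p i).eval σ) * q k - C ((q i).eval σ) * p k).eval τ ≠ 0) (by
    intro A hA
    let B : Finset F := A ∪
      (Finset.univ : Finset (ι × ι)).biUnion
        (fun ik => (p ik.1 * q ik.2 - q ik.1 * p ik.2).roots.toFinset) ∪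
      (A ×ˢ (Finset.univ : Finset (ι × ι))).biUnion (fun z =>
        (C ((p z.2.1).eval z.1) * q z.2.2 - C ((q z.2.1).eval z.1) * p z.2.2).roots.toFinset)
    obtain ⟨τ, hτ⟩ := Infinite.exists_notMem_finset B
    simp only [B, Finset.mem_union, not_or, Finset.mem_biUnion, not_exists, not_and,
      Multiset.mem_toFinset, Finset.mem_product, Finset.mem_univ, and_true, true_and] at hτ
    obtain ⟨⟨h1, h2⟩, h3⟩ := hτ
    refine ⟨τ, fun i k hik h => h2 (i, k) ((mem_roots (hdet i k hik)).2 h), fun σ hσ =>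
      ⟨fun h => h1 (h ▸ hσ), fun i k h => h3 (σ, i, k) hσ ((mem_roots fun h0 => ?_).2 h)⟩⟩
    obtain ⟨hx, hy⟩ := hind _ _ _ h0
    obtain ⟨i', hi'⟩ := exists_ne i
    exact hA σ hσ i i' hi'.symm (by simp [hx, hy]))
  refine ⟨τ, fun a b h => ?_, fun i j k l h => ?_⟩
  · by_contra hab
    rcases lt_or_gt_of_ne hab with hlt | hlt
    · exact (hr a b hlt).1 h
    · exact (hr b a hlt).1 h.symm
  rcases lt_trichotomy j l with hjl | rfl | hjl
  · simpa using (hr j l hjl).2 i k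
  · simpa using hP j i k (fun hik => h (by rw [hik]))
  · intro h0
    refine (hr l j hjl).2 k i ?_
    simp only [eval_sub, eval_mul, eval_C]
    linear_combination -h0

open Polynomial in
/-- Pairs of polynomials summing to zero, pairwise non-proportional, such that all but the first
pair consist of scaled monomials. -/
theorem exists_polynomial_pairs_sum_zero {F : Type*} [Field F] [CharZero F] {t : ℕ} (ht : 2 ≤ t) :
    ∃ p q : Fin (t + 1) → F[X], (∑ i, p i = 0) ∧ (∑ i, q i = 0) ∧
      (∀ i k, i ≠ k → p i * q k - q i * p k ≠ 0) ∧
      (∀ i (x y : F), C x * q i - C y * p i = 0 → x = 0 ∧ y = 0) ∧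
      (∀ i : Fin t, p i.succ = X ^ (2 * (i : ℕ))) ∧
      ∀ i : Fin t, q i.succ = C ((i : F) + 1) * X ^ (2 * (i : ℕ) + 1) := by
  let p₀ : Fin t → F[X] := fun i => X ^ (2 * (i : ℕ))
  let q₀ : Fin t → F[X] := fun i => C ((i : F) + 1) * X ^ (2 * (i : ℕ) + 1)
  have hdet₀ : ∀ i k, p₀ i * q₀ k - q₀ i * p₀ k
      = C ((k : F) - (i : F)) * X ^ (2 * (i : ℕ) + 2 * (k : ℕ) + 1) := by
    intro i k
    simp only [p₀, q₀, map_sub, map_add]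
    ring
  have hsum₀ : ∀ i, p₀ i * (∑ k, q₀ k) - q₀ i * (∑ k, p₀ k) ≠ 0 := by
    intro i h
    rw [Finset.mul_sum, Finset.mul_sum, ← Finset.sum_sub_distrib] at h
    simp only [hdet₀] at h
    have : Nontrivial (Fin t) := Fin.nontrivial_iff_two_le.2 ht
    obtain ⟨k, hk⟩ := exists_ne i
    have h' := congrArg (fun f => coeff f (2 * (i : ℕ) + 2 * (k : ℕ) + 1)) h
    simp only [finsetSum_coeff, coeff_C_mul, coeff_X_pow, coeff_zero] at h'
    rw [Finset.sum_eq_single k] at h'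
    · simp only [if_true, mul_one, sub_eq_zero, Nat.cast_inj] at h'
      exact hk (Fin.ext h')
    · intro l _ hl
      have : (l : ℕ) ≠ k := fun h => hl (Fin.ext h)
      rw [if_neg (by omega), mul_zero]
    · simp
  have hone : ∀ i : Fin t, (i : F) + 1 ≠ 0 := fun i => Nat.cast_add_one_ne_zero _
  refine ⟨Fin.cons (-∑ i, p₀ i) p₀, Fin.cons (-∑ i, q₀ i) q₀, ?_, ?_, ?_, ?_, ?_, ?_⟩
  · simp [Fin.sum_univ_succ]
  · simp [Fin.sum_univ_succ]
  · intro i k hik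
    induction i using Fin.cases with
    | zero =>
      induction k using Fin.cases with
      | zero => exact absurd rfl hik
      | succ k =>
        intro h
        refine hsum₀ k ?_
        simp only [Fin.cons_zero, Fin.cons_succ] at h
        linear_combination h
    | succ i =>
      induction k using Fin.cases with
      | zero =>
        intro h
        refine hsum₀ i ?_
        simp only [Fin.cons_zero, Fin.cons_succ] at h
        linear_combination -h
      | succ k =>
        simp only [Fin.cons_succ, hdet₀]
        refine mul_ne_zero ?_ (pow_ne_zero _ X_ne_zero)
        rw [Ne, C_eq_zero, sub_eq_zero, Nat.cast_inj]
        exact fun h => hik (congrArg Fin.succ (Fin.ext h.symm))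
  · have key : ∀ (i : Fin t) (x y : F) (N : ℕ),
        coeff (C x * q₀ i - C y * p₀ i) N =
          (if N = 2 * (i : ℕ) + 1 then x * ((i : F) + 1) else 0) -
            if N = 2 * (i : ℕ) then y else 0 := by
      intro i x y N
      simp only [p₀, q₀, coeff_sub, coeff_C_mul, coeff_X_pow]
      split_ifs <;> simp
    intro i x y h
    induction i using Fin.cases with
    | zero =>
      simp only [Fin.cons_zero, mul_neg] at h
      have h2 : ∑ i, (C x * q₀ i - C y * p₀ i) = 0 := by
        rw [Finset.sum_sub_distrib, ← Finset.mul_sum, ← Finset.mul_sum]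
        linear_combination -h
      have hc : ∀ N, ∑ i, coeff (C x * q₀ i - C y * p₀ i) N = 0 := by
        intro N
        rw [← finsetSum_coeff, h2, coeff_zero]
      let z : Fin t := ⟨0, by omega⟩
      have h0 := hc 0
      have h1 := hc 1
      simp only [key] at h0 h1
      rw [Finset.sum_eq_single z (fun l _ hl => by
        have : (l : ℕ) ≠ 0 := fun h => hl (Fin.ext h)
        rw [if_neg (by omega), if_neg (by omega), sub_zero]) (by simp)] at h0 h1
      simp [z] at h0 h1
      exact ⟨h1, h0⟩
    | succ i =>
      simp only [Fin.cons_succ] at h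
      have h0 := key i x y (2 * (i : ℕ))
      have h1 := key i x y (2 * (i : ℕ) + 1)
      rw [h] at h0 h1
      simp at h0 h1
      exact ⟨h1.resolve_right (hone i), h0⟩
  · intro i; rfl
  · intro i; rfl

theorem ite_mem_hammingSource {F : Type*} [Field F] {s n : ℕ} (v : Fin n → F) (i : Fin s) (a : F)
    (j : Fin n) : (fun i' => if i' = i then v + a • (Pi.single j (1 : F) : Fin n → F) else v) ∈
      HammingSource F s n :=
  ⟨v, i, a, j, rfl⟩

/-- With at least three terminals, a lossless linear compression has total code length at least
`n + 2`. -/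
theorem Lossless.add_two_le_sum {F : Type*} [Field F] {s n : ℕ} (hs : 3 ≤ s) (hn : 1 ≤ n)
    {m : Fin s → ℕ} {H : ∀ i, Matrix (Fin (m i)) (Fin n) F}
    (hH : Lossless H (HammingSource F s n)) : n + 2 ≤ ∑ i, m i := by
  let e : Fin n → F := Pi.single ⟨0, hn⟩ 1
  let i₀ : Fin s := ⟨0, by omega⟩
  let i₁ : Fin s := ⟨1, by omega⟩
  let i₂ : Fin s := ⟨2, by omega⟩
  let g : ((Fin n → F) × F × F) →ₗ[F] (∀ i, Fin (m i) → F) := LinearMap.pi fun i =>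
    (H i).mulVecLin ∘ₗ (LinearMap.fst F _ _ +
      (if i = i₀ then LinearMap.toSpanSingleton F _ e ∘ₗ LinearMap.fst F F F ∘ₗ
        LinearMap.snd F _ _ else 0) +
      (if i = i₁ then LinearMap.toSpanSingleton F _ e ∘ₗ LinearMap.snd F F F ∘ₗ
        LinearMap.snd F _ _ else 0))
  have hg : Function.Injective g := by
    rw [injective_iff_map_eq_zero]
    rintro ⟨u, a, b⟩ h
    have hxy := hH (ite_mem_hammingSource u i₀ a ⟨0, hn⟩)
      (ite_mem_hammingSource 0 i₁ (-b) ⟨0, hn⟩) (by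
        funext i
        have hi := congrFun h i
        refine sub_eq_zero.1 (Eq.trans ?_ hi)
        simp only [g, LinearMap.pi_apply, LinearMap.comp_apply, Matrix.mulVecLin_apply,
          ← Matrix.mulVec_sub]
        congr 1
        split_ifs <;> simp [e])
    have h2 := congrFun hxy i₂
    have h0 := congrFun (congrFun hxy i₀) ⟨0, hn⟩
    have h1 := congrFun (congrFun hxy i₁) ⟨0, hn⟩
    have hu : u = 0 := by simpa [i₀, i₁, i₂] using h2
    subst hu
    have ha : a = 0 := by simpa [i₀, i₁] using h0
    have hb : b = 0 := by simpa [i₀, i₁] using h1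
    simp [ha, hb]
  have h := LinearMap.finrank_le_finrank_of_injective hg
  simpa [Module.finrank_pi_fintype] using h

/-- In a lossless linear compression of the Hamming source with `n ≥ 2`, every code length is at
least two. -/
theorem Lossless.two_le {F : Type*} [Field F] {s n : ℕ} (hn : 2 ≤ n)
    {m : Fin s → ℕ} {H : ∀ i, Matrix (Fin (m i)) (Fin n) F}
    (hH : Lossless H (HammingSource F s n)) (i : Fin s) : 2 ≤ m i := by
  let j₀ : Fin n := ⟨0, by omega⟩
  let j₁ : Fin n := ⟨1, by omega⟩
  let g : (F × F) →ₗ[F] (Fin (m i) → F) := (H i).mulVecLin ∘ₗ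
    (LinearMap.toSpanSingleton F _ (Pi.single j₀ 1) ∘ₗ LinearMap.fst F F F +
      LinearMap.toSpanSingleton F _ (Pi.single j₁ 1) ∘ₗ LinearMap.snd F F F)
  have hg : Function.Injective g := by
    rw [injective_iff_map_eq_zero]
    rintro ⟨a, b⟩ h
    have hxy := hH (ite_mem_hammingSource 0 i a j₀) (ite_mem_hammingSource 0 i (-b) j₁) (by
      funext k
      by_cases hk : k = i
      · subst hk
        rw [← sub_eq_zero, ← h]
        simp [g, ← Matrix.mulVec_sub]
      · simp [hk])
    have h0 := congrFun (congrFun hxy i) j₀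
    have h1 := congrFun (congrFun hxy i) j₁
    have ha : a = 0 := by simpa [j₀, j₁] using h0
    have hb : b = 0 := by simpa [j₀, j₁] using h1.symm
    simp [ha, hb]
  have h := LinearMap.finrank_le_finrank_of_injective hg
  simpa using h

/-- A sufficient criterion for losslessness: some two rows of the matrices sum to zero over the
terminals, their columns are pairwise non-proportional, and the common kernel is trivial. -/
theorem lossless_hammingSource_of_rows {F : Type*} [Field F] {s n : ℕ}
    {m : Fin s → ℕ} (H : ∀ i, Matrix (Fin (m i)) (Fin n) F) (r₀ r₁ : ∀ i, Fin (m i))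
    (h₀ : ∀ j, ∑ i, H i (r₀ i) j = 0) (h₁ : ∀ j, ∑ i, H i (r₁ i) j = 0)
    (hdet : ∀ i j k l, (i, j) ≠ (k, l) →
      H i (r₀ i) j * H k (r₁ k) l - H i (r₁ i) j * H k (r₀ k) l ≠ 0)
    (hker : ∀ u : Fin n → F, (∀ i, (H i).mulVec u = 0) → u = 0) (hs : 2 ≤ s) :
    Lossless H (HammingSource F s n) := by
  have hsum : ∀ (r : ∀ i, Fin (m i)), (∀ j, ∑ i, H i (r i) j = 0) →
      ∀ (v : Fin n → F) (i : Fin s) (a : F) (j : Fin n),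
      ∑ i', (H i').mulVec (if i' = i then v + a • (Pi.single j (1 : F) : Fin n → F) else v) (r i')
        = a * H i (r i) j := by
    intro r hr v i a j
    have h : ∀ i', (H i').mulVec (if i' = i then v + a • (Pi.single j (1 : F) : Fin n → F) else v)
        (r i') = (H i').mulVec v (r i') + if i' = i then a * H i (r i) j else 0 := by
      intro i'
      split_ifs with hi
      · subst hi
        simp [Matrix.mulVec_add, Matrix.mulVec_smul]
      · simp
    simp only [h, Finset.sum_add_distrib, Finset.sum_ite_eq', Finset.mem_univ, if_true]
    simp only [Matrix.mulVec, dotProduct]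
    rw [Finset.sum_comm]
    simp [← Finset.sum_mul, hr]
  rintro _ ⟨v, i, a, j, rfl⟩ _ ⟨w, k, b, l, rfl⟩ hxy
  have hxy' := fun i' => congrFun hxy i'
  simp only at hxy'
  have e₀ : a * H i (r₀ i) j = b * H k (r₀ k) l := by
    rw [← hsum r₀ h₀ v i a j, ← hsum r₀ h₀ w k b l]
    exact Finset.sum_congr rfl fun i' _ => congrFun (hxy' i') _
  have e₁ : a * H i (r₁ i) j = b * H k (r₁ k) l := by
    rw [← hsum r₁ h₁ v i a j, ← hsum r₁ h₁ w k b l]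
    exact Finset.sum_congr rfl fun i' _ => congrFun (hxy' i') _
  have hδ : ∀ i', (if i' = i then a • (Pi.single j (1 : F) : Fin n → F) else 0) =
      if i' = k then b • (Pi.single l (1 : F) : Fin n → F) else 0 := by
    by_cases hij : (i, j) = (k, l)
    · obtain ⟨rfl, rfl⟩ := Prod.mk.inj hij
      have : Nontrivial (Fin s) := Fin.nontrivial_iff_two_le.2 hs
      obtain ⟨c, hc⟩ := exists_ne i
      have hd := hdet i j c j (fun h => hc (Prod.mk.inj h).1.symm)
      have hab : a = b := by
        by_contra hne
        have hne' := sub_ne_zero.2 hne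
        have z₀ : H i (r₀ i) j = 0 :=
          (mul_eq_zero.1 (show (a - b) * _ = 0 by rw [sub_mul, e₀, sub_self])).resolve_left hne'
        have z₁ : H i (r₁ i) j = 0 :=
          (mul_eq_zero.1 (show (a - b) * _ = 0 by rw [sub_mul, e₁, sub_self])).resolve_left hne'
        exact hd (by rw [z₀, z₁]; ring)
      simp [hab]
    · have hd := hdet i j k l hij
      have ha : a = 0 := (mul_eq_zero.1 (show a * _ = 0 by
        linear_combination H k (r₁ k) l * e₀ - H k (r₀ k) l * e₁)).resolve_right hd
      have hb : b = 0 := (mul_eq_zero.1 (show b * _ = 0 by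
        linear_combination H i (r₁ i) j * e₀ - H i (r₀ i) j * e₁)).resolve_right hd
      simp [ha, hb]
  have hsplit : ∀ (v : Fin n → F) (i i' : Fin s) (a : F) (j : Fin n),
      (if i' = i then v + a • (Pi.single j (1 : F) : Fin n → F) else v) =
        v + if i' = i then a • (Pi.single j (1 : F) : Fin n → F) else 0 := by
    intro v i i' a j
    split_ifs <;> simp
  simp only [hsplit, hδ, Matrix.mulVec_add, add_left_inj] at hxy'
  have hvw : v - w = 0 := hker _ fun i' => by rw [Matrix.mulVec_sub, hxy', sub_self]
  funext i'
  rw [hsplit, hsplit, hδ, sub_eq_zero.1 hvw]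

/-- over a field of characteristic zero, with `s ≥ 3` and `n ≥ 2`, there is
a lossless linear compression of the Hamming source with total code length exactly
`max(n + 2, 2s)`, and it is linear-optimal. -/
theorem stmt_17 {F : Type*} [Field F] [CharZero F] {s n : ℕ} (hs : 3 ≤ s) (hn : 2 ≤ n) :
    ∃ (m : Fin s → ℕ) (H : ∀ i, Matrix (Fin (m i)) (Fin n) F),
      Lossless H (HammingSource F s n) ∧
      (∑ i, m i) = max (n + 2) (2 * s) ∧
      ∀ (m' : Fin s → ℕ) (H' : ∀ i, Matrix (Fin (m' i)) (Fin n) F),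
        Lossless H' (HammingSource F s n) → (∑ i, m i) ≤ ∑ i, m' i := by
  suffices h : ∃ (m : Fin s → ℕ) (H : ∀ i, Matrix (Fin (m i)) (Fin n) F),
      Lossless H (HammingSource F s n) ∧ (∑ i, m i) = max (n + 2) (2 * s) by
    obtain ⟨m, H, hH, hm⟩ := h
    refine ⟨m, H, hH, hm, fun m' H' hH' => ?_⟩
    rw [hm]
    refine max_le (hH'.add_two_le_sum hs (by omega)) ?_
    calc 2 * s = ∑ _i : Fin s, 2 := by simp [mul_comm]
      _ ≤ _ := Finset.sum_le_sum fun i _ => hH'.two_le hn i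
  obtain ⟨t, rfl⟩ : ∃ t, s = t + 1 := ⟨s - 1, by omega⟩
  obtain ⟨p, q, hp, hq, hdet, hind, hps, hqs⟩ :=
    exists_polynomial_pairs_sum_zero (F := F) (t := t) (by omega)
  have : Nontrivial (Fin (t + 1)) := Fin.nontrivial_iff_two_le.2 (by omega)
  obtain ⟨τ, hτ, hτdet⟩ := exists_seq_eval_pairwise_det_ne_zero p q hdet hind
  let m : Fin (t + 1) → ℕ := Fin.cons (2 + (n - 2 * t)) fun _ => 2
  have hm : ∀ i, 2 ≤ m i := by
    intro i
    induction i using Fin.cases <;> simp [m]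
  let H : ∀ i, Matrix (Fin (m i)) (Fin n) F := fun i r j =>
    if (r : ℕ) = 0 then (p i).eval (τ j) else if (r : ℕ) = 1 then (q i).eval (τ j)
      else τ j ^ (2 * t + r - 2)
  refine ⟨m, H, lossless_hammingSource_of_rows H (fun i => ⟨0, by have := hm i; omega⟩)
    (fun i => ⟨1, hm i⟩) ?_ ?_ ?_ ?_ (by omega), ?_⟩
  · intro j
    simp only [H, if_true]
    rw [← Polynomial.eval_finsetSum, hp, Polynomial.eval_zero]
  · intro j
    simp only [H, one_ne_zero, if_true, if_false]
    rw [← Polynomial.eval_finsetSum, hq, Polynomial.eval_zero]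
  · intro i j k l h
    simp only [H, one_ne_zero, if_true, if_false]
    exact hτdet i j k l (fun h' => h (by
      obtain ⟨h1, h2⟩ := Prod.mk.inj h'
      rw [h1, Fin.ext h2]))
  · intro u hu
    refine Matrix.eq_zero_of_forall_pow_sum_mul_pow_eq_zero (f := fun j : Fin n => τ j)
      (fun a b h => Fin.ext (hτ h)) fun k => ?_
    have hrow : ∀ i r, ∑ j, H i r j * u j = 0 := fun i r => congrFun (hu i) r
    by_cases hk : (k : ℕ) < 2 * t
    · let i : Fin t := ⟨k / 2, by omega⟩
      rcases Nat.mod_two_eq_zero_or_one k with h | h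
      · have := hrow i.succ ⟨0, by have := hm i.succ; omega⟩
        simp only [H, if_true, hps, Polynomial.eval_pow, Polynomial.eval_X] at this
        rw [← this]
        refine Finset.sum_congr rfl fun j _ => ?_
        rw [mul_comm, show 2 * (i : ℕ) = k by simp only [i]; omega]
      · have := hrow i.succ ⟨1, hm i.succ⟩
        simp only [H, one_ne_zero, if_true, if_false, hqs, Polynomial.eval_pow, Polynomial.eval_X,
          Polynomial.eval_mul, Polynomial.eval_C, mul_assoc] at this
        rw [← Finset.mul_sum] at this
        rw [← (mul_eq_zero.1 this).resolve_left (Nat.cast_add_one_ne_zero _)]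
        refine Finset.sum_congr rfl fun j _ => ?_
        rw [mul_comm, show 2 * (i : ℕ) + 1 = k by simp only [i]; omega]
    · have := hrow 0 ⟨2 + (k - 2 * t), by simp only [m, Fin.cons_zero]; omega⟩
      simp only [H] at this
      rw [← this]
      refine Finset.sum_congr rfl fun j _ => ?_
      rw [if_neg (by omega), if_neg (by omega), mul_comm,
        show 2 * t + (2 + ((k : ℕ) - 2 * t)) - 2 = k by omega]
  · simp only [m, Fin.sum_univ_succ, Fin.cons_zero, Fin.cons_succ, Finset.sum_const,
      Finset.card_univ, Fintype.card_fin, smul_eq_mul]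
    omega
end

section
/- (Structure of compressible sources) Let F be a field, s ≥ 2 and n ≥ 1 integers, and S a source with deviation symmetry in (F^n)^s. Call S compressible if there exist matrices H_1, …, H_s over F, with H_i of size m_i × n and m_1 + ⋯ + m_s < sn, forming a lossless linear compression of S. Then S is compressible if and only if there exist a permutation π of {1, …, s}, an invertible n × n matrix B over F, a subset D_- of F^{n−1} × (F^n)^{s−2}, and a function f : D_- → F, such that the set D = { the s-tuple obtained by applying the position permutation π to the tuple (B·u(d), d_2, …, d_{s−1}, 0) : d = (d_1, d_2, …, d_{s−1}) ∈ D_- } is a representative set of S, where u(d) ∈ F^n denotes the column vector whose first entry is f(d) and whose remaining n − 1 entries form the vector d_1 ∈ F^{n−1}. -/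
open Matrix

/-- A source with deviation symmetry: `S ⊆ (F^n)^s` is closed under uniform shifts. -/
def DevSym {F : Type*} [Field F] {s n : ℕ} (S : Set (Fin s → Fin n → F)) : Prop :=
  ∀ x ∈ S, ∀ v : Fin n → F, (fun i => x i + v) ∈ S

/-- `D` is a representative set of `S`: `D ⊆ S` and every `σ ∈ S` is uniquely
`σ = (d_1 + v, …, d_s + v)` with `(d_1,…,d_s) ∈ D`, `v ∈ F^n`. -/
def RepSet {F : Type*} [Field F] {s n : ℕ} (S D : Set (Fin s → Fin n → F)) : Prop :=
  D ⊆ S ∧ ∀ σ ∈ S, ∃! dv : (Fin s → Fin n → F) × (Fin n → F),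
    dv.1 ∈ D ∧ σ = fun i => dv.1 i + dv.2

/-- The vectorized representative set `D̃ ⊆ F^{sn}` (identifying `(F^n)^s ≃ F^{sn}`). -/
def vecD {F : Type*} [Field F] {s n : ℕ} (D : Set (Fin s → Fin n → F)) :
    Set (Fin s × Fin n → F) :=
  (fun d (p : Fin s × Fin n) => d p.1 p.2) '' D

/-- The parent matrix `P = [Q_1 | ⋯ | Q_s]`. -/
def parentMatrix {F : Type*} [Field F] {s n r : ℕ}
    (Q : Fin s → Matrix (Fin r) (Fin n) F) : Matrix (Fin r) (Fin s × Fin n) F :=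
  Matrix.of fun k p => Q p.1 k p.2

/-- The `s`-tuple `(B·[c; d_1], d_2, …, d_{s-1}, 0)`. -/
def augTuple {F : Type*} [Field F] {s n : ℕ} (B : Matrix (Fin n) (Fin n) F) (c : F)
    (d : (Fin (n - 1) → F) × (Fin (s - 2) → Fin n → F)) : Fin s → Fin n → F :=
  fun i' : Fin s =>
    if hi0 : i'.val = 0 then
      B.mulVec (fun j : Fin n =>
        if hj : j.val = 0 then c
        else d.1 ⟨j.val - 1, by have := j.isLt; omega⟩)
    else if hi : i'.val < s - 1 then
      d.2 ⟨i'.val - 1, by have := i'.isLt; omega⟩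
    else 0

section augTuple

variable {F : Type*} [Field F] {s n : ℕ} (B : Matrix (Fin n) (Fin n) F)

lemma augTuple_of_val_eq_zero (c : F) (d : (Fin (n - 1) → F) × (Fin (s - 2) → Fin n → F))
    {i : Fin s} (hi : i.val = 0) :
    augTuple B c d i = B.mulVec (fun j : Fin n =>
      if hj : j.val = 0 then c else d.1 ⟨j.val - 1, by have := j.isLt; omega⟩) := by
  simp [augTuple, hi]

lemma augTuple_of_val_eq_sub_one (hs : 2 ≤ s) (c : F)
    (d : (Fin (n - 1) → F) × (Fin (s - 2) → Fin n → F))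
    {i : Fin s} (hi : i.val = s - 1) : augTuple B c d i = 0 := by
  have h0 : ¬ i.val = 0 := by omega
  have h1 : ¬ i.val < s - 1 := by omega
  simp only [augTuple, h0, h1, dite_false]

lemma augTuple_congr_of_val_ne_zero (c c' : F)
    (d : (Fin (n - 1) → F) × (Fin (s - 2) → Fin n → F)) {i : Fin s} (hi : i.val ≠ 0) :
    augTuple B c d i = augTuple B c' d i := by
  simp [augTuple, hi]

lemma augTuple_of_val_eq_zero_sub (c c' : F)
    (d : (Fin (n - 1) → F) × (Fin (s - 2) → Fin n → F)) {i : Fin s} (hi : i.val = 0)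
    (z : Fin n) (hz : z.val = 0) :
    augTuple B c d i - augTuple B c' d i = (c - c') • B.mulVec (Pi.single z 1) := by
  rw [augTuple_of_val_eq_zero B c d hi, augTuple_of_val_eq_zero B c' d hi,
    ← Matrix.mulVec_sub, ← Matrix.mulVec_smul]
  congr 1
  funext j
  by_cases hj : j.val = 0
  · have : j = z := Fin.ext (hj.trans hz.symm)
    subst this
    simp [hz]
  · have : j ≠ z := fun h => hj (h ▸ hz)
    simp [hj, this]

/-- The parameter `(d_1, …, d_{s-1})` is determined by the middle entries of `augTuple` and the
last `n - 1` coordinates of `B⁻¹` applied to its first entry. -/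
lemma augTuple_param_ext (hB : IsUnit B) {c c' : F}
    {d d' : (Fin (n - 1) → F) × (Fin (s - 2) → Fin n → F)} (z : Fin s) (hz : z.val = 0)
    (h0 : ∀ j : Fin n, j.val ≠ 0 →
      (B⁻¹).mulVec (augTuple B c d z) j = (B⁻¹).mulVec (augTuple B c' d' z) j)
    (h1 : ∀ i : Fin s, i.val ≠ 0 → augTuple B c d i = augTuple B c' d' i) : d = d' := by
  have hdet := (Matrix.isUnit_iff_isUnit_det B).mp hB
  refine Prod.ext (funext fun k => ?_) (funext fun k => ?_)
  · have h := h0 ⟨k.val + 1, by have := k.isLt; omega⟩ (by simp)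
    rw [augTuple_of_val_eq_zero B c d hz, augTuple_of_val_eq_zero B c' d' hz,
      Matrix.mulVec_mulVec, Matrix.mulVec_mulVec, Matrix.nonsing_inv_mul B hdet] at h
    simpa using h
  · have hk : k.val + 1 < s - 1 := by have := k.isLt; omega
    have h := h1 ⟨k.val + 1, by omega⟩ (by simp)
    simpa [augTuple, hk] using h

lemma exists_augTuple_eq (hn : 1 ≤ n) (hB : IsUnit B) (y : Fin s → Fin n → F)
    (hy : ∀ i : Fin s, i.val = s - 1 → y i = 0) (hs : 2 ≤ s) :
    ∃ c d, augTuple B c d = y := by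
  have hdet := (Matrix.isUnit_iff_isUnit_det B).mp hB
  refine ⟨(B⁻¹).mulVec (y ⟨0, by omega⟩) ⟨0, by omega⟩,
    (fun k => (B⁻¹).mulVec (y ⟨0, by omega⟩) ⟨k.val + 1, by have := k.isLt; omega⟩,
      fun k => y ⟨k.val + 1, by have := k.isLt; omega⟩), funext fun i => ?_⟩
  by_cases hi : i.val = 0
  · rw [augTuple_of_val_eq_zero B _ _ hi]
    have hi' : i = ⟨0, by omega⟩ := Fin.ext hi
    have hv : (B⁻¹).mulVec (y i) = fun j : Fin n =>
        if hj : j.val = 0 then (B⁻¹).mulVec (y ⟨0, by omega⟩) ⟨0, by omega⟩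
        else (B⁻¹).mulVec (y ⟨0, by omega⟩) ⟨j.val - 1 + 1, by have := j.isLt; omega⟩ := by
      funext j
      rw [hi']
      split_ifs with hj
      · exact congrArg _ (Fin.ext hj)
      · exact congrArg _ (Fin.ext (by simp only; omega))
    rw [← hv, Matrix.mulVec_mulVec, Matrix.mul_nonsing_inv B hdet, Matrix.one_mulVec]
  · by_cases hl : i.val < s - 1
    · simp only [augTuple, hi, hl, dite_true, dite_false]
      exact congrArg y (Fin.ext (by simp only; omega))
    · have hl' : i.val = s - 1 := by have := i.isLt; omega
      rw [augTuple_of_val_eq_sub_one B hs _ _ hl', hy i hl']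

end augTuple

lemma exists_isUnit_mulVec_single_eq {F ι : Type*} [Field F] [Fintype ι] [DecidableEq ι]
    (z : ι) {b : ι → F} (hb : b ≠ 0) :
    ∃ B : Matrix ι ι F, IsUnit B ∧ B.mulVec (Pi.single z 1) = b := by
  obtain ⟨k, hk⟩ := Function.ne_iff.mp hb
  refine ⟨((1 : Matrix ι ι F).updateCol k b).submatrix id (Equiv.swap z k), ?_, ?_⟩
  · rw [Matrix.isUnit_iff_isUnit_det, Matrix.det_permute', ← Matrix.cramer_apply,
      Matrix.cramer_one]
    refine IsUnit.mul ?_ (isUnit_iff_ne_zero.mpr hk)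
    exact (Units.isUnit _).map (Int.castRingHom F)
  · ext j
    simp

lemma Matrix.exists_mulVec_eq_zero_of_lt {F : Type*} [Field F] {m n : ℕ}
    (A : Matrix (Fin m) (Fin n) F) (h : m < n) : ∃ b ≠ 0, A.mulVec b = 0 := by
  have := LinearMap.ker_ne_bot_of_finrank_lt (f := A.mulVecLin) (by simpa using h)
  obtain ⟨b, hb, hb0⟩ := Submodule.exists_mem_ne_zero_of_ne_bot this
  exact ⟨b, hb0, by simpa using hb⟩

lemma exists_repSet_augTuple_of_injective_mod {F : Type*} [Field F] {s n : ℕ} (hs : 2 ≤ s) (hn : 1 ≤ n)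
    {S : Set (Fin s → Fin n → F)} (hSym : DevSym S) (i₀ : Fin s) {b : Fin n → F} (hb : b ≠ 0)
    (hinj : ∀ σ ∈ S, ∀ τ ∈ S, (∀ i ≠ i₀, σ i = τ i) →
      (∃ c : F, σ i₀ - τ i₀ = c • b) → σ = τ) :
    ∃ (π : Equiv.Perm (Fin s)) (B : Matrix (Fin n) (Fin n) F), IsUnit B ∧
      ∃ (Dm : Set ((Fin (n - 1) → F) × (Fin (s - 2) → Fin n → F))) (f : Dm → F),
        RepSet S {x | ∃ d : Dm, x = fun i => augTuple B (f d) d (π i)} := by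
  let z : Fin s := ⟨0, by omega⟩
  let l : Fin s := ⟨s - 1, by omega⟩
  let π : Equiv.Perm (Fin s) := Equiv.swap i₀ z
  obtain ⟨B, hB, hBb⟩ := exists_isUnit_mulVec_single_eq (⟨0, by omega⟩ : Fin n) hb
  have hπz : π i₀ = z := Equiv.swap_apply_left _ _
  have hπ : ∀ i, (π i).val = 0 ↔ i = i₀ := fun i => by
    rw [← π.injective.eq_iff, hπz, Fin.ext_iff]
  let Dm : Set ((Fin (n - 1) → F) × (Fin (s - 2) → Fin n → F)) :=
    {d | ∃ c, (fun i => augTuple B c d (π i)) ∈ S}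
  let f : Dm → F := fun d => d.2.choose
  have hf : ∀ d : Dm, (fun i => augTuple B (f d) d (π i)) ∈ S := fun d => d.2.choose_spec
  have hfc : ∀ (c : F) d (h : (fun i => augTuple B c d (π i)) ∈ S),
      (fun i => augTuple B c d (π i)) = fun i => augTuple B (f ⟨d, c, h⟩) d (π i) := by
    intro c d h
    refine hinj _ h _ (hf ⟨d, c, h⟩) (fun i hi => ?_) ⟨c - f ⟨d, c, h⟩, ?_⟩
    · exact augTuple_congr_of_val_ne_zero B _ _ d fun h => hi ((hπ i).mp h)
    · rw [← hBb]
      exact augTuple_of_val_eq_zero_sub B _ _ d ((hπ i₀).mpr rfl) _ rfl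
  refine ⟨π, B, hB, Dm, f, ?_, fun σ hσ => ?_⟩
  · rintro x ⟨d, rfl⟩
    exact hf d
  · have hτ : (fun i => σ i - σ (π.symm l)) ∈ S := by
      simpa [sub_eq_add_neg] using hSym σ hσ (-σ (π.symm l))
    obtain ⟨c, d, hcd⟩ := exists_augTuple_eq B hn hB
      (fun i => σ (π.symm i) - σ (π.symm l)) (fun i hi => by
        rw [show i = l from Fin.ext hi, sub_self]) hs
    have hcd' : (fun i => augTuple B c d (π i)) = fun i => σ i - σ (π.symm l) := by
      simp [hcd]
    refine ⟨(fun i => σ i - σ (π.symm l), σ (π.symm l)), ⟨?_, by simp⟩, ?_⟩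
    · have h := hfc c d (hcd' ▸ hτ)
      exact ⟨_, hcd'.symm.trans h⟩
    · rintro ⟨x, v⟩ ⟨⟨d', rfl⟩, h⟩
      have hv : σ (π.symm l) = v := by
        have := congrFun h (π.symm l)
        simpa [augTuple_of_val_eq_sub_one B hs _ _ (show l.val = s - 1 from rfl)] using this
      refine Prod.ext (funext fun i => ?_) hv.symm
      simp only
      rw [hv, h, add_sub_cancel_right]

lemma exists_lossless_of_repSet {F : Type*} [Field F] {s n : ℕ} (hs : 2 ≤ s) (hn : 1 ≤ n)
    {S : Set (Fin s → Fin n → F)} (π : Equiv.Perm (Fin s)) (B : Matrix (Fin n) (Fin n) F)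
    (hB : IsUnit B) (Dm : Set ((Fin (n - 1) → F) × (Fin (s - 2) → Fin n → F))) (f : Dm → F)
    (hD : RepSet S {x | ∃ d : Dm, x = fun i => augTuple B (f d) d (π i)}) :
    ∃ (m : Fin s → ℕ) (H : ∀ i, Matrix (Fin (m i)) (Fin n) F),
      (∑ i, m i) < s * n ∧ Lossless H S := by
  let z : Fin s := ⟨0, by omega⟩
  let l : Fin s := ⟨s - 1, by omega⟩
  let m : Fin s → ℕ := fun i => if (π i).val = 0 then n - 1 else n
  have hm0 : ∀ {i}, (π i).val = 0 → m i = n - 1 := fun h => if_pos h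
  have hm1 : ∀ {i}, ¬ (π i).val = 0 → m i = n := fun h => if_neg h
  let H : ∀ i, Matrix (Fin (m i)) (Fin n) F := fun i r =>
    if h : (π i).val = 0 then B⁻¹ ⟨r.val + 1, by have := r.isLt; have := hm0 h; omega⟩
    else (1 : Matrix (Fin n) (Fin n) F) ⟨r.val, by have := r.isLt; have := hm1 h; omega⟩
  refine ⟨m, H, ?_, fun σ hσ τ hτ hστ => ?_⟩
  · calc ∑ i, m i < ∑ _i : Fin s, n := by
          refine Finset.sum_lt_sum (fun i _ => ?_) ⟨π.symm z, Finset.mem_univ _, ?_⟩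
          · simp only [m]; split_ifs <;> omega
          · rw [hm0 (by simp [z])]; omega
      _ = s * n := by simp
  · have h0 : ∀ i, (π i).val = 0 → ∀ j : Fin n, j.val ≠ 0 →
        (B⁻¹).mulVec (σ i) j = (B⁻¹).mulVec (τ i) j := by
      intro i hi j hj
      have h := congrFun (congrFun hστ i)
        ⟨j.val - 1, by have := j.isLt; have := hm0 hi; omega⟩
      have hj' : j.val - 1 + 1 = j.val := by omega
      simpa [H, Matrix.mulVec, hi, hj'] using h
    have h1 : ∀ i, (π i).val ≠ 0 → σ i = τ i := by
      intro i hi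
      funext j
      have h := congrFun (congrFun hστ i) ⟨j.val, by have := j.isLt; have := hm1 hi; omega⟩
      have hH : ∀ x : Fin n → F, (H i).mulVec x
          ⟨j.val, by have := j.isLt; have := hm1 hi; omega⟩ = x j := by
        intro x
        simp only [H, Matrix.mulVec, hi, dite_false]
        exact congrFun (Matrix.one_mulVec x) j
      simpa only [hH] using h
    obtain ⟨⟨_, v⟩, ⟨⟨d, rfl⟩, hσd⟩, -⟩ := hD.2 σ hσ
    obtain ⟨⟨_, w⟩, ⟨⟨d', rfl⟩, hτd⟩, -⟩ := hD.2 τ hτ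
    simp only at hσd hτd
    have hvw : v = w := by
      have h := h1 (π.symm l) (by simp only [Equiv.apply_symm_apply, l]; omega)
      rw [hσd, hτd] at h
      simpa [augTuple_of_val_eq_sub_one B hs _ _ (show l.val = s - 1 from rfl)] using h
    subst hvw
    have hdd : d = d' := by
      refine Subtype.ext (augTuple_param_ext B hB (c := f d) (c' := f d') z rfl
        (fun j hj => ?_) (fun i hi => ?_))
      · have h := h0 (π.symm z) (by simp [z]) j hj
        rw [hσd, hτd] at h
        simpa [Matrix.mulVec_add] using h
      · have h := h1 (π.symm i) (by simpa using hi)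
        rw [hσd, hτd] at h
        simpa using h
    rw [hσd, hτd, hdd]

/-- Theorem on structure of compressible sources, Theorem 4s.1:
a source with deviation symmetry `S` admits a lossless linear compression into a
strictly smaller space (`m_1 + ⋯ + m_s < sn`) iff, for some position permutation `π`,
some invertible matrix `B`, some `D_- ⊆ F^{n-1} × (F^n)^{s-2}` and some `f : D_- → F`,
the set `D = {π-permutation of (B·[f(d); d_1], d_2, …, d_{s-1}, 0) : d ∈ D_-}` is a
representative set of `S`. -/
theorem stmt_19 {F : Type*} [Field F] {s n : ℕ} (hs : 2 ≤ s) (hn : 1 ≤ n)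
    (S : Set (Fin s → Fin n → F)) (hSym : DevSym S) :
    (∃ (m : Fin s → ℕ) (H : ∀ i, Matrix (Fin (m i)) (Fin n) F),
      (∑ i, m i) < s * n ∧ Lossless H S) ↔
    (∃ (π : Equiv.Perm (Fin s)) (B : Matrix (Fin n) (Fin n) F), IsUnit B ∧
      ∃ (Dm : Set ((Fin (n - 1) → F) × (Fin (s - 2) → Fin n → F))) (f : Dm → F),
        RepSet S
          {x : Fin s → Fin n → F | ∃ d : Dm, x = fun i : Fin s =>
            (fun i' : Fin s =>
              if hi0 : i'.val = 0 then
                B.mulVec (fun j : Fin n =>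
                  if hj : j.val = 0 then f d
                  else (d : (Fin (n - 1) → F) × (Fin (s - 2) → Fin n → F)).1
                    ⟨j.val - 1, by have := j.isLt; omega⟩)
              else if hi : i'.val < s - 1 then
                (d : (Fin (n - 1) → F) × (Fin (s - 2) → Fin n → F)).2 ⟨i'.val - 1, by have := i'.isLt; omega⟩
              else 0) (π i)}) := by
  constructor
  · rintro ⟨m, H, hm, hH⟩
    obtain ⟨i₀, -, hi₀⟩ : ∃ i ∈ Finset.univ, m i < n :=
      Finset.exists_lt_of_sum_lt (by simpa using hm)
    obtain ⟨b, hb, hHb⟩ := (H i₀).exists_mulVec_eq_zero_of_lt hi₀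
    refine exists_repSet_augTuple_of_injective_mod hs hn hSym i₀ hb ?_
    rintro σ hσ τ hτ h ⟨c, hc⟩
    refine hH hσ hτ (funext fun i => ?_)
    by_cases hi : i = i₀
    · subst hi
      simp only
      rw [← sub_eq_zero, ← Matrix.mulVec_sub, hc, Matrix.mulVec_smul, hHb, smul_zero]
    · simp only [h i hi]
  · rintro ⟨π, B, hB, Dm, f, hD⟩
    exact exists_lossless_of_repSet hs hn π B hB Dm f hD
end
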